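/- Let G : ℝⁿ → ℝⁿ be continuously differentiable, let μ₁,…,μₘ < 0 be real, Ωˢ = diag(μ₁,…,μₘ), δ > 0, B_δ = {σ ∈ ℝᵐ : max_i |σ_i| < δ}, and let P : B_δ → ℝⁿ be continuously differentiable with G(P(σ)) = DP(σ)(Ωˢσ) for all σ ∈ B_δ. For each σ ∈ B_δ let M_σ : [0,∞) → Mₙ(ℝ) be the solution of the matrix ODE M_σ'(x) = DG(P(e^{Ωˢx}σ)) M_σ(x) with M_σ(0) = I. Let μ ∈ ℝ and let W : B_δ → ℝⁿ be continuously differentiable. Then the following are equivalent: (1) for all σ ∈ B_δ and all x ≥ 0, M_σ(x) W(σ) = e^{μx} W(e^{Ωˢx}σ); (2) for all σ ∈ B_δ, DG(P(σ)) W(σ) = μ W(σ) + DW(σ)(Ωˢσ). -/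

import Mathlib

/-- Two solutions on `[0, ∞)` of a linear differential equation with continuous coefficients agree
when their initial values agree. -/
theorem eqOn_Ici_of_linear_ode {E : Type*} [NormedAddCommGroup E] [NormedSpace ℝ E]
    {A : ℝ → E →L[ℝ] E} (hA : ContinuousOn A (Set.Ici 0)) {u v : ℝ → E}
    (hu : ∀ x ∈ Set.Ici (0 : ℝ), HasDerivWithinAt u (A x (u x)) (Set.Ici 0) x)
    (hv : ∀ x ∈ Set.Ici (0 : ℝ), HasDerivWithinAt v (A x (v x)) (Set.Ici 0) x)
    (h0 : u 0 = v 0) : Set.EqOn u v (Set.Ici 0) := by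
  intro b hb
  obtain ⟨K, hK⟩ := isCompact_Icc.exists_bound_of_continuousOn
    (hA.mono (Set.Icc_subset_Ici_self : Set.Icc 0 b ⊆ Set.Ici 0))
  have hw : ∀ x ∈ Set.Ici (0 : ℝ),
      HasDerivWithinAt (u - v) (A x ((u - v) x)) (Set.Ici 0) x := fun x hx => by
    simpa using (hu x hx).sub (hv x hx)
  have hz := eq_zero_of_abs_deriv_le_mul_abs_self_of_eq_zero_right
    (fun x hx => ((hw x hx.1).continuousWithinAt.mono Set.Icc_subset_Ici_self :
      ContinuousWithinAt (u - v) (Set.Icc 0 b) x))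
    (fun x hx => (hw x hx.1).mono (Set.Ici_subset_Ici.2 hx.1)) (by simp [h0])
    (fun x hx => (A x).le_of_opNorm_le (hK x (Set.Ico_subset_Icc_self hx)) _)
    b (Set.right_mem_Icc.2 hb)
  exact sub_eq_zero.1 hz

theorem hasDerivAt_exp_mul_apply {ι : Type*} [Fintype ι] (a σ : ι → ℝ) (x : ℝ) :
    HasDerivAt (fun (t : ℝ) i => Real.exp (a i * t) * σ i)
      (fun i => a i * (Real.exp (a i * x) * σ i)) x := by
  refine hasDerivAt_pi.2 fun i => ?_
  refine (((hasDerivAt_id x).const_mul (a i)).exp.mul_const (σ i)).congr_deriv ?_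
  simp only [id]
  ring

theorem abs_exp_mul_lt {a x s δ : ℝ} (ha : a ≤ 0) (hx : 0 ≤ x) (hs : |s| < δ) :
    |Real.exp (a * x) * s| < δ := by
  rw [abs_mul, Real.abs_exp]
  exact (mul_le_of_le_one_left (abs_nonneg s)
    (Real.exp_le_one_iff.2 (mul_nonpos_of_nonpos_of_nonneg ha hx))).trans_lt hs

/-- The derivative of `W`, evaluated along the linear flow and rescaled by `exp (μ x)`. -/
theorem hasDerivAt_exp_smul_comp_exp {ι F : Type*} [Fintype ι] [NormedAddCommGroup F]
    [NormedSpace ℝ F] {W : (ι → ℝ) → F} {W' : (ι → ℝ) →L[ℝ] F} (a σ : ι → ℝ) (μ x : ℝ)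
    (hW : HasFDerivAt W W' fun i => Real.exp (a i * x) * σ i) :
    HasDerivAt (fun t : ℝ => Real.exp (μ * t) • W fun i => Real.exp (a i * t) * σ i)
      (Real.exp (μ * x) • (μ • W (fun i => Real.exp (a i * x) * σ i) +
        W' fun i => a i * (Real.exp (a i * x) * σ i))) x := by
  have he : HasDerivAt (fun t : ℝ => Real.exp (μ * t)) (Real.exp (μ * x) * μ) x := by
    simpa using ((hasDerivAt_id x).const_mul μ).exp
  have hc := hW.comp_hasDerivAt (f := fun (t : ℝ) i => Real.exp (a i * t) * σ i) x
    (hasDerivAt_exp_mul_apply a σ x)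
  refine (he.smul hc).congr_deriv ?_
  simp only [smul_add, smul_smul, Function.comp_apply]
  exact add_comm _ _

/-- **Parameterization-method lemma for rank-one invariant vector bundles
(Lemma `parameterization for bundles`).**
Let `G` be `C¹`, `μ₁,…,μₘ < 0`, `Ωˢ = diag(μ₁,…,μₘ)`, and let `P` parameterize the stable
manifold (`G(P σ) = DP σ (Ωˢ σ)` on `B_δ`). For each `σ ∈ B_δ`, let `M σ` be the principal
fundamental matrix solution of the variational equation along `x ↦ P (e^{Ωˢ x} σ)` on `[0,∞)`.
Then `M σ x (W σ) = e^{μ x} W (e^{Ωˢ x} σ)` for all `σ ∈ B_δ`, `x ≥ 0`, iff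
`DG(P σ) (W σ) = μ W σ + DW σ (Ωˢ σ)` for all `σ ∈ B_δ`. -/
theorem parameterization_lemma_bundles
    {n m : ℕ}
    (G : (Fin n → ℝ) → (Fin n → ℝ)) (hG : ContDiff ℝ 1 G)
    (μs : Fin m → ℝ) (hμs : ∀ i, μs i < 0)
    (δ : ℝ) (hδ : 0 < δ)
    (P : (Fin m → ℝ) → (Fin n → ℝ))
    (DP : (Fin m → ℝ) → ((Fin m → ℝ) →L[ℝ] (Fin n → ℝ)))
    (hP : ∀ σ : Fin m → ℝ, (∀ i, |σ i| < δ) → HasFDerivAt P (DP σ) σ)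
    (hDPcont : ContinuousOn DP {σ : Fin m → ℝ | ∀ i, |σ i| < δ})
    (hinv : ∀ σ : Fin m → ℝ, (∀ i, |σ i| < δ) → G (P σ) = DP σ fun i => μs i * σ i)
    (M : (Fin m → ℝ) → ℝ → ((Fin n → ℝ) →L[ℝ] (Fin n → ℝ)))
    (hM0 : ∀ σ : Fin m → ℝ, (∀ i, |σ i| < δ) →
      M σ 0 = ContinuousLinearMap.id ℝ (Fin n → ℝ))
    (hM : ∀ σ : Fin m → ℝ, (∀ i, |σ i| < δ) → ∀ x ∈ Set.Ici (0 : ℝ),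
      HasDerivWithinAt (M σ)
        ((fderiv ℝ G (P fun i => Real.exp (μs i * x) * σ i)).comp (M σ x))
        (Set.Ici 0) x)
    (μ : ℝ)
    (W : (Fin m → ℝ) → (Fin n → ℝ))
    (DW : (Fin m → ℝ) → ((Fin m → ℝ) →L[ℝ] (Fin n → ℝ)))
    (hW : ∀ σ : Fin m → ℝ, (∀ i, |σ i| < δ) → HasFDerivAt W (DW σ) σ)
    (hDWcont : ContinuousOn DW {σ : Fin m → ℝ | ∀ i, |σ i| < δ}) :
    (∀ σ : Fin m → ℝ, (∀ i, |σ i| < δ) → ∀ x : ℝ, 0 ≤ x →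
        M σ x (W σ) = Real.exp (μ * x) • W fun i => Real.exp (μs i * x) * σ i)
      ↔
    (∀ σ : Fin m → ℝ, (∀ i, |σ i| < δ) →
        fderiv ℝ G (P σ) (W σ) = μ • W σ + DW σ fun i => μs i * σ i) := by
  have hflow : ∀ σ : Fin m → ℝ, (∀ i, |σ i| < δ) → ∀ x ∈ Set.Ici (0 : ℝ),
      ∀ i, |Real.exp (μs i * x) * σ i| < δ :=
    fun σ hσ x hx i => abs_exp_mul_lt (hμs i).le hx (hσ i)
  have hu : ∀ σ : Fin m → ℝ, (∀ i, |σ i| < δ) → ∀ x ∈ Set.Ici (0 : ℝ),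
      HasDerivWithinAt (fun t => M σ t (W σ))
        (fderiv ℝ G (P fun i => Real.exp (μs i * x) * σ i) (M σ x (W σ))) (Set.Ici 0) x :=
    fun σ hσ x hx => by
      simpa using (hM σ hσ x hx).clm_apply (hasDerivWithinAt_const x (Set.Ici 0) (W σ))
  have hv : ∀ σ : Fin m → ℝ, (∀ i, |σ i| < δ) → ∀ x ∈ Set.Ici (0 : ℝ), _ :=
    fun σ hσ x hx => (hasDerivAt_exp_smul_comp_exp μs σ μ x
      (hW _ (hflow σ hσ x hx))).hasDerivWithinAt (s := Set.Ici 0)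
  constructor
  · intro h σ hσ
    have h0 : (0 : ℝ) ∈ Set.Ici (0 : ℝ) := Set.self_mem_Ici
    have hd := (hv σ hσ 0 h0).congr (fun x hx => h σ hσ x hx) (h σ hσ 0 le_rfl)
    simpa [hM0 σ hσ] using
      (uniqueDiffOn_Ici (0 : ℝ) 0 h0).eq_deriv _ (hu σ hσ 0 h0) hd
  · intro h σ hσ
    refine eqOn_Ici_of_linear_ode
      (A := fun x => fderiv ℝ G (P fun i => Real.exp (μs i * x) * σ i)) ?_ (hu σ hσ) ?_ ?_
    · intro x hx
      refine ((hG.continuous_fderiv one_ne_zero).continuousAt.comp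
        (ContinuousAt.comp (f := fun (t : ℝ) i => Real.exp (μs i * t) * σ i) ?_
          (hasDerivAt_exp_mul_apply μs σ x).continuousAt)).continuousWithinAt
      exact (hP _ (hflow σ hσ x hx)).continuousAt
    · intro x hx
      simpa only [map_smul, h _ (hflow σ hσ x hx)] using hv σ hσ x hx
    · simp [hM0 σ hσ]
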